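/- Let x, y ∈ {0,1,…,d}^{ℤ^d} be an indistinguishable asymptotic pair satisfying the flip condition. Then for every finite nonempty S ⊆ ℤ^d, every pattern p : S → {0,…,d} in the language of x or of y occurs in x at some position n ∈ F − S (i.e., there is n with n+S meeting F and x(n+s)=p(s) for all s ∈ S). In particular #(ℒ_S(x) ∪ ℒ_S(y)) ≤ #(F − S). -/

import Mathlib

/-- Points of the lattice `ℤ^d`. -/
abbrev Zd (d : ℕ) := Fin d → ℤ

/-- Occurrences of the pattern `p` (with support `S`) in the configuration `x`. -/
def occs {d : ℕ} {A : Type*} (x : Zd d → A) (S : Finset (Zd d)) (p : Zd d → A) : Set (Zd d) :=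
  {n | ∀ s ∈ S, x (n + s) = p s}

/-- `x` and `y` differ on finitely many sites. -/
def IsAsymptoticPair {d : ℕ} {A : Type*} (x y : Zd d → A) : Prop :=
  {v | x v ≠ y v}.Finite

/-- Indistinguishable asymptotic pair. -/
def Indistinguishable {d : ℕ} {A : Type*} (x y : Zd d → A) : Prop :=
  IsAsymptoticPair x y ∧
  ∀ (S : Finset (Zd d)) (p : Zd d → A),
    (occs x S p \ occs y S p).ncard = (occs y S p \ occs x S p).ncard

/-- The set `F = {0, -e₁, …, -e_d}`. -/
def flipF (d : ℕ) : Finset (Zd d) :=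
  insert 0 (Finset.univ.image fun i : Fin d => -(Pi.single i 1 : Zd d))

/-- The flip condition for an asymptotic pair over the alphabet `{0,1,…,d}`. -/
def FlipCondition {d : ℕ} (x y : Zd d → Fin (d + 1)) : Prop :=
  {v | x v ≠ y v} = ↑(flipF d) ∧
  Set.BijOn x ↑(flipF d) Set.univ ∧
  x 0 = 0 ∧
  ∀ n ∈ flipF d, y n = x n - 1

/-- The language of `x` with support `S`, seen as functions `↥S → A`. -/
def langOn {d : ℕ} {A : Type*} (x : Zd d → A) (S : Finset (Zd d)) : Set (S → A) :=
  {q | ∃ n : Zd d, ∀ s : S, x (n + (s : Zd d)) = q s}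

/-- Minkowski difference `F - S` of two finite subsets of `ℤ^d`. -/
def fms {d : ℕ} (F S : Finset (Zd d)) : Finset (Zd d) := Finset.image₂ (· - ·) F S

/-- Nearest-neighbour adjacency on `ℤ^d`. -/
def ZAdj {d : ℕ} (u v : Zd d) : Prop :=
  ∃ i : Fin d, v - u = Pi.single i 1 ∨ u - v = Pi.single i 1

/-- A finite subset of `ℤ^d` is connected for the nearest-neighbour graph. -/
def FinsetConnected {d : ℕ} (S : Finset (Zd d)) : Prop :=
  ∀ u ∈ S, ∀ v ∈ S, Relation.ReflTransGen (fun a b => ZAdj a b ∧ a ∈ S ∧ b ∈ S) u v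

/-- The scalar product `n · α`. -/
def dotA {d : ℕ} (α : Fin d → ℝ) (n : Zd d) : ℝ := ∑ i, (n i : ℝ) * α i

/-- Lower `d`-dimensional Sturmian configuration with slope `α` and intercept `ρ`. -/
noncomputable def sLow {d : ℕ} (α : Fin d → ℝ) (ρ : ℝ) (n : Zd d) : ℤ :=
  ∑ i, (⌊α i + dotA α n + ρ⌋ - ⌊dotA α n + ρ⌋)

/-- Lower characteristic `d`-dimensional Sturmian configuration with slope `α`. -/
noncomputable def cLow {d : ℕ} (α : Fin d → ℝ) (n : Zd d) : ℤ :=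
  ∑ i, (⌊α i + dotA α n⌋ - ⌊dotA α n⌋)

/-- Upper characteristic `d`-dimensional Sturmian configuration with slope `α`. -/
noncomputable def cUp {d : ℕ} (α : Fin d → ℝ) (n : Zd d) : ℤ :=
  ∑ i, (⌈α i + dotA α n⌉ - ⌈dotA α n⌉)

/-- `{1, α₁, …, α_d}` is linearly independent over `ℚ`. -/
def TotallyIrrational {d : ℕ} (α : Fin d → ℝ) : Prop :=
  ∀ (a : ℚ) (q : Fin d → ℚ), ((a : ℝ) + ∑ i, (q i : ℝ) * α i = 0) → a = 0 ∧ q = 0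

lemma mem_fms {d : ℕ} {F S : Finset (Zd d)} {n s : Zd d} (hs : s ∈ S) (h : n + s ∈ F) :
    n ∈ fms F S :=
  Finset.mem_image₂.mpr ⟨n + s, h, s, hs, by simp⟩

/-- An occurrence of a pattern in only one of two configurations meets their difference set. -/
lemma occs_sdiff_subset_fms {d : ℕ} {A : Type*} {x y : Zd d → A} {F : Finset (Zd d)}
    (hF : ∀ v, x v ≠ y v → v ∈ F) (S : Finset (Zd d)) (p : Zd d → A) :
    occs x S p \ occs y S p ⊆ fms F S := by
  rintro n ⟨hx, hy⟩
  simp only [occs, Set.mem_ofPred_eq, not_forall] at hx hy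
  obtain ⟨s, hs, hne⟩ := hy
  exact mem_fms hs (hF _ fun h => hne (h ▸ hx s hs))

namespace Indistinguishable

variable {d : ℕ} {A : Type*} {x y : Zd d → A} {F : Finset (Zd d)}

lemma symm (h : Indistinguishable x y) : Indistinguishable y x :=
  ⟨by simpa only [IsAsymptoticPair, ne_comm] using h.1, fun S p => (h.2 S p).symm⟩

lemma nonempty_occs_sdiff (h : Indistinguishable x y) {S : Finset (Zd d)} {p : Zd d → A}
    (hne : (occs x S p \ occs y S p).Nonempty) : (occs y S p \ occs x S p).Nonempty := by
  refine Set.nonempty_of_ncard_ne_zero ?_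
  rw [← h.2 S p]
  have hfin := (Finset.finite_toSet _).subset
    (occs_sdiff_subset_fms (fun v => (h.1.mem_toFinset (a := v)).mpr) S p)
  exact ((Set.ncard_pos hfin).mpr hne).ne.symm

/-- A pattern that never occurs in `x` on the difference set has the same occurrences in both
configurations. -/
lemma occs_eq_of_forall_notMem (h : Indistinguishable x y) (hF : ∀ v, x v ≠ y v → v ∈ F)
    {S : Finset (Zd d)} {p : Zd d → A} (hp : ∀ n ∈ fms F S, n ∉ occs x S p) :
    occs x S p = occs y S p := by
  have hxy : occs x S p ⊆ occs y S p := by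
    intro n hn
    by_contra hy
    exact hp n (occs_sdiff_subset_fms hF S p ⟨hn, hy⟩) hn
  refine hxy.antisymm (Set.sdiff_eq_empty.mp (Set.not_nonempty_iff_eq_empty.mp fun hne => ?_))
  obtain ⟨n, hn, hn'⟩ := h.symm.nonempty_occs_sdiff hne
  exact hn' (hxy hn)

/-- An occurrence of a pattern avoiding the difference set can be translated by some vector
sending a prescribed site of the difference set to a site where `y` carries the same letter. -/
lemma exists_translate_mem_occs (h : Indistinguishable x y) (hF : ∀ v, x v ≠ y v → v ∈ F)
    {S : Finset (Zd d)} {p : Zd d → A} (hp : ∀ n ∈ fms F S, n ∉ occs x S p)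
    {n f : Zd d} (hn : n ∈ occs x S p) (hf : x f ≠ y f) :
    ∃ k, k + f ∈ F ∧ y (k + f) = x f ∧ n + k ∈ occs x S p := by
  classical
  let T := insert f (S.image (n + ·))
  have hne : (occs x T x \ occs y T x).Nonempty :=
    ⟨0, fun s _ => by rw [zero_add],
      fun h0 => hf (by simpa using (h0 f (Finset.mem_insert_self _ _)).symm)⟩
  obtain ⟨k, hk, hk'⟩ := h.nonempty_occs_sdiff hne
  have hnk : n + k ∈ occs x S p := by
    rw [h.occs_eq_of_forall_notMem hF hp]
    intro s hs
    rw [← hn s hs, ← hk (n + s) (Finset.mem_insert_of_mem (Finset.mem_image_of_mem _ hs))]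
    congr 1
    abel
  refine ⟨k, ?_, hk f (Finset.mem_insert_self _ _), hnk⟩
  simp only [occs, Set.mem_ofPred_eq, not_forall] at hk'
  obtain ⟨t, ht, hne⟩ := hk'
  have hkt : k + t ∈ F := hF _ fun e => hne (e.trans (hk t ht))
  rcases Finset.mem_insert.mp ht with rfl | ht
  · exact hkt
  · obtain ⟨s, hs, rfl⟩ := Finset.mem_image.mp ht
    exact absurd hnk (hp _ (mem_fms hs (by convert hkt using 1; abel)))

end Indistinguishable

/-- A set of lattice points stable under the translations by the differences of elements of
`flipF d` is empty or everything. -/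
lemma mem_of_flipF_sub_mem {d : ℕ} {O : Set (Zd d)}
    (hO : ∀ n ∈ O, ∀ f ∈ flipF d, ∀ g ∈ flipF d, n + (g - f) ∈ O) {n : Zd d} (hn : n ∈ O)
    (m : Zd d) : m ∈ O := by
  let H : AddSubgroup (Zd d) :=
    { carrier := {k | ∀ n ∈ O, n + k ∈ O ∧ n - k ∈ O}
      zero_mem' := fun n hn => by simpa using hn
      add_mem' := fun {a b} ha hb n hn =>
        ⟨by simpa only [add_assoc] using (hb _ (ha n hn).1).1,
          by simpa only [sub_sub] using (hb _ (ha n hn).2).2⟩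
      neg_mem' := fun {a} ha n hn =>
        ⟨by simpa only [← sub_eq_add_neg] using (ha n hn).2,
          by simpa only [sub_neg_eq_add] using (ha n hn).1⟩ }
  have h0 : (0 : Zd d) ∈ flipF d := Finset.mem_insert_self _ _
  have hsingle (i : Fin d) : (Pi.single i 1 : Zd d) ∈ H := fun n hn => by
    have hi : -(Pi.single i 1 : Zd d) ∈ flipF d :=
      Finset.mem_insert_of_mem (Finset.mem_image_of_mem _ (Finset.mem_univ i))
    exact ⟨by simpa using hO n hn _ hi _ h0, by simpa [sub_eq_add_neg] using hO n hn _ h0 _ hi⟩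
  have hH : m - n ∈ H := by
    refine AddSubgroup.pi_mem_of_single_mem _ fun i => ?_
    have := H.zsmul_mem (hsingle i) ((m - n) i)
    rwa [← Pi.single_smul, smul_eq_mul, mul_one] at this
  simpa using (hH n hn).1

open Fin.CommRing in
/-- If the pattern `p` does not occur in `x` on `flipF d`, then its set of occurrences is stable
under the translations by the differences of elements of `flipF d`. -/
lemma FlipCondition.add_sub_mem_occs {d : ℕ} {x y : Zd d → Fin (d + 1)}
    (hflip : FlipCondition x y) (hind : Indistinguishable x y) {S : Finset (Zd d)}
    {p : Zd d → Fin (d + 1)} (hp : ∀ n ∈ fms (flipF d) S, n ∉ occs x S p)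
    {n f g : Zd d} (hn : n ∈ occs x S p) (hf : f ∈ flipF d) (hg : g ∈ flipF d) :
    n + (g - f) ∈ occs x S p := by
  obtain ⟨hdiff, ⟨-, hinj, hsurj⟩, -, hy⟩ := hflip
  have hF (v : Zd d) : x v ≠ y v ↔ v ∈ flipF d := Set.ext_iff.mp hdiff v
  have key (j : ℕ) : ∀ g ∈ flipF d, x g = x f + (j : Fin (d + 1)) → n + (g - f) ∈ occs x S p := by
    induction j with
    | zero =>
      intro g hg hgf
      obtain rfl := hinj hg hf (by simpa using hgf)
      simpa using hn
    | succ j ih =>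
      intro g hg hgf
      obtain ⟨e, he, hxe⟩ := hsurj (Set.mem_univ (x f + (j : Fin (d + 1))))
      obtain ⟨k, hk, hyk, hmem⟩ := hind.exists_translate_mem_occs (fun v => (hF v).mp) hp
        (ih e he hxe) ((hF e).mpr he)
      have hkg : k + e = g := by
        refine hinj hk hg ?_
        rw [hy _ hk, sub_eq_iff_eq_add, hxe] at hyk
        rw [hyk, hgf, Nat.cast_succ, add_assoc]
      convert hmem using 1
      rw [← hkg]
      abel
  exact key (x g - x f).val g hg (by simp)

/-- For an indistinguishable asymptotic pair satisfying the flip condition,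
every pattern of the language of `x` or `y` with finite nonempty support `S` occurs in `x` at
some position in `F - S`; in particular `#(ℒ_S(x) ∪ ℒ_S(y)) ≤ #(F - S)`. -/
theorem language_occurs_on_fms {d : ℕ} (x y : Zd d → Fin (d + 1))
    (hind : Indistinguishable x y) (hflip : FlipCondition x y)
    (S : Finset (Zd d)) (hS : S.Nonempty) :
    (∀ p : S → Fin (d + 1), p ∈ langOn x S ∪ langOn y S →
      ∃ n ∈ fms (flipF d) S, ∀ s : S, x (n + (s : Zd d)) = p s) ∧
    (langOn x S ∪ langOn y S).ncard ≤ (fms (flipF d) S).card := by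
  have hocc : ∀ p : S → Fin (d + 1), p ∈ langOn x S ∪ langOn y S →
      ∃ n ∈ fms (flipF d) S, ∀ s : S, x (n + (s : Zd d)) = p s := by
    intro p hp
    let q : Zd d → Fin (d + 1) := fun v => if h : v ∈ S then p ⟨v, h⟩ else 0
    have hq (z : Zd d → Fin (d + 1)) (n : Zd d) :
        n ∈ occs z S q ↔ ∀ s : S, z (n + (s : Zd d)) = p s := by
      simp +contextual [occs, q]
    by_contra! hcon
    have hnot : ∀ n ∈ fms (flipF d) S, n ∉ occs x S q := fun n hn hmem => by
      obtain ⟨s, hs⟩ := hcon n hn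
      exact hs ((hq x n).mp hmem s)
    have heq := hind.occs_eq_of_forall_notMem (fun v => (Set.ext_iff.mp hflip.1 v).mp) hnot
    obtain ⟨n, hn⟩ : (occs x S q).Nonempty := by
      rcases hp with ⟨n, hn⟩ | ⟨n, hn⟩
      · exact ⟨n, (hq x n).mpr hn⟩
      · exact ⟨n, heq ▸ (hq y n).mpr hn⟩
    obtain ⟨s, hs⟩ := hS
    have h0 : (0 : Zd d) ∈ flipF d := Finset.mem_insert_self _ _
    exact hnot (-s) (mem_fms hs (by simpa using h0))
      (mem_of_flipF_sub_mem
        (fun m hm f hf g hg => hflip.add_sub_mem_occs hind hnot hm hf hg) hn _)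
  refine ⟨hocc, ?_⟩
  classical
  calc (langOn x S ∪ langOn y S).ncard
      ≤ (((fms (flipF d) S).image fun n (s : S) => x (n + (s : Zd d)) :
          Finset (S → Fin (d + 1))) : Set (S → Fin (d + 1))).ncard := by
        refine Set.ncard_le_ncard (fun p hp => ?_) (Finset.finite_toSet _)
        obtain ⟨n, hn, h⟩ := hocc p hp
        exact Finset.mem_coe.mpr (Finset.mem_image.mpr ⟨n, hn, funext h⟩)
    _ ≤ (fms (flipF d) S).card := by
        rw [Set.ncard_coe_finset]
        exact Finset.card_image_le
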